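/- Every finite abelian group G whose order n is divisible by 9 satisfies f_max(G) ≥ 3^{n/9}. In particular, if additionally no prime p with p ≡ 2 (mod 3) divides n, then μ(G) = n/3 and hence f_max(G) ≥ 3^{μ(G)/3}. -/

import Mathlib

/-- A subset `A` of an additive group is *sum-free* if there are no
`x, y, z ∈ A` (not necessarily distinct) with `x + y = z`. -/
def IsSumFree {G : Type*} [AddCommGroup G] (A : Set G) : Prop :=
  ∀ x ∈ A, ∀ y ∈ A, x + y ∉ A

/-- `A` is a maximal sum-free subset of `G`. -/
def IsMaximalSumFree {G : Type*} [AddCommGroup G] (A : Set G) : Prop :=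
  IsSumFree A ∧ ∀ B : Set G, IsSumFree B → A ⊆ B → A = B

/-- `μ(G)`: the maximum size of a sum-free subset of `G`. -/
noncomputable def sumFreeMu (G : Type*) [AddCommGroup G] [Fintype G] : ℕ :=
  sSup {k : ℕ | ∃ A : Set G, IsSumFree A ∧ A.ncard = k}

/-- `f_max(G)`: the number of maximal sum-free subsets of `G`. -/
noncomputable def fMaxSF (G : Type*) [AddCommGroup G] [Fintype G] : ℕ :=
  Nat.card {A : Set G // IsMaximalSumFree A}

/-- Every sum-free subset of a finite group extends to a maximal one. -/
lemma IsSumFree.exists_isMaximalSumFree {G : Type*} [AddCommGroup G] [Finite G] {A : Set G}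
    (hA : IsSumFree A) : ∃ M, A ⊆ M ∧ IsMaximalSumFree M := by
  obtain ⟨M, hAM, hM⟩ := Finite.exists_le_maximal (p := fun B : Set G => IsSumFree B) hA
  exact ⟨M, hAM, hM.prop, fun B hB hMB => hM.eq_of_le hB hMB⟩

lemma exists_surjective_zmod_of_ne_zero {V : Type*} [AddCommGroup V] (p : ℕ) [Fact p.Prime]
    [Module (ZMod p) V] {v : V} (hv : v ≠ 0) : ∃ f : V →+ ZMod p, Function.Surjective f := by
  obtain ⟨f, hf⟩ : ∃ f : Module.Dual (ZMod p) V, f v ≠ 0 := by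
    by_contra! h
    exact hv ((Module.forall_dual_apply_eq_zero_iff (ZMod p) v).mp h)
  exact ⟨f.toAddMonoidHom, LinearMap.surjective (f := f) fun h => hf (by simp [h])⟩

/-- A finite abelian group of order divisible by a prime `p` surjects onto `ZMod p`. -/
lemma exists_surjective_zmod {G : Type*} [AddCommGroup G] [Finite G] (p : ℕ) [Fact p.Prime]
    (hp : p ∣ Nat.card G) : ∃ φ : G →+ ZMod p, Function.Surjective φ := by
  let R : AddSubgroup G := (nsmulAddMonoidHom p : G →+ G).range
  let _ : Module (ZMod p) (G ⧸ R) := QuotientAddGroup.zmodModule fun x => ⟨x, rfl⟩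
  obtain ⟨v, hv⟩ : ∃ v : G, v ∉ R := by
    by_contra! h
    have hinj : Function.Injective (nsmulAddMonoidHom p : G →+ G) :=
      Finite.injective_iff_surjective.mpr fun x => h x
    obtain ⟨s, hs⟩ := exists_prime_addOrderOf_dvd_card' p hp
    have hs0 : s = 0 := hinj (by simp [← hs, addOrderOf_nsmul_eq_zero])
    rw [hs0, addOrderOf_zero] at hs
    exact (Fact.out : p.Prime).one_lt.ne hs
  obtain ⟨f, hf⟩ := exists_surjective_zmod_of_ne_zero p
    (mt (QuotientAddGroup.eq_zero_iff v).mp hv)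
  exact ⟨f.comp (QuotientAddGroup.mk' R), hf.comp (QuotientAddGroup.mk'_surjective R)⟩

/-- The fibres of a surjection onto `ZMod p` all have the same size. -/
lemma mul_card_fiber_eq_card {G : Type*} [AddCommGroup G] [Finite G] {p : ℕ} [NeZero p]
    {φ : G →+ ZMod p} (hφ : Function.Surjective φ) (c : ZMod p) :
    p * Nat.card {x // φ x = c} = Nat.card G := by
  classical
  have := Fintype.ofFinite G
  have h : Nat.card G = ∑ d : ZMod p, ({x | φ x = d} : Finset G).card := by
    rw [Nat.card_eq_fintype_card, ← Finset.card_univ]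
    exact Finset.card_eq_sum_card_fiberwise fun _ _ => by simp
  rw [h, Finset.sum_congr rfl fun d _ =>
    AddMonoidHom.card_fiber_eq_of_mem_range φ (hφ d) (hφ c)]
  simp [Fintype.card_subtype]

/-- If `φ` maps onto `ZMod 3` and kills an element of order three, then transversals of the
cosets of this element inside `φ ⁻¹' {1}` give many maximal sum-free sets. -/
lemma three_pow_le_card_isMaximalSumFree {G : Type*} [AddCommGroup G] [Finite G]
    {φ : G →+ ZMod 3} (hφ : Function.Surjective φ) {s : G} (hs : addOrderOf s = 3)
    (hφs : φ s = 0) {m : ℕ} (hm : Nat.card G = 9 * m) :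
    3 ^ m ≤ Nat.card {A : Set G // IsMaximalSumFree A} := by
  classical
  let K := AddSubgroup.zmultiples s
  have hs0 : s ≠ 0 := by
    rintro rfl
    simp at hs
  have hKφ : K ≤ φ.ker := by simpa [K] using hφs
  have hKcard : Nat.card K = 3 := by rw [Nat.card_zmultiples, hs]
  have hK : ∀ d ∈ K, d ≠ 0 → d = s ∨ -d = s := by
    intro d hd hd0
    obtain ⟨k, hk, rfl⟩ := (mem_zmultiples_iff_mem_range_addOrderOf).mp hd |> Finset.mem_image.mp
    have h3 : 3 • s = 0 := hs ▸ addOrderOf_nsmul_eq_zero s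
    rw [hs, Finset.mem_range] at hk
    interval_cases k
    · simp at hd0
    · simp
    · right
      rw [neg_eq_iff_add_eq_zero, ← succ_nsmul, h3]
  let ψ : G ⧸ K →+ ZMod 3 := QuotientAddGroup.lift K φ hKφ
  have hψ : ∀ x : G, ψ x = φ x := fun x => rfl
  have hψsurj : Function.Surjective ψ := fun y => (hφ y).imp' _ fun x hx => (hψ x).trans hx
  let Q := {q : G ⧸ K // ψ q = 1}
  have hQ : Nat.card Q = m := by
    have h1 : 3 * Nat.card Q = Nat.card (G ⧸ K) := mul_card_fiber_eq_card hψsurj 1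
    have h2 := K.card_eq_card_quotient_mul_card_addSubgroup
    rw [hKcard] at h2
    omega
  let r (c : Q → K) (q : Q) : G := q.1.out + c q
  have hr_mk : ∀ c q, ((r c q : G) : G ⧸ K) = q.1 := by
    intro c q
    simp only [r, QuotientAddGroup.mk_add, QuotientAddGroup.out_eq',
      (QuotientAddGroup.eq_zero_iff _).mpr (c q).2, add_zero]
  have hφr : ∀ c q, φ (r c q) = 1 := fun c q => by rw [← hψ, hr_mk, q.2]
  have h01 : (0 : ZMod 3) ≠ 1 := by decide
  have h20 : (1 + 1 : ZMod 3) ≠ 0 := by decide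
  have h21 : (1 + 1 : ZMod 3) ≠ 1 := by decide
  have hs_add : ∀ c q q', s + r c q ≠ r c q' := by
    intro c q q' h
    have hqq : q = q' := by
      apply Subtype.ext
      rw [← hr_mk c q', ← h, QuotientAddGroup.mk_add, hr_mk,
        (QuotientAddGroup.eq_zero_iff s).mpr (AddSubgroup.mem_zmultiples s), zero_add]
    subst hqq
    exact hs0 (by simpa using h)
  have hfree : ∀ c, IsSumFree (insert s (Set.range (r c))) := by
    rintro c x (rfl | ⟨q, rfl⟩) y (rfl | ⟨q', rfl⟩) (h | ⟨q'', h⟩)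
    · exact hs0 (by simpa using h)
    · exact h01 (by simpa [hφs, hφr] using (congrArg φ h).symm)
    · exact h01 (by simpa [hφs, hφr] using (congrArg φ h).symm)
    · exact hs_add c _ _ h.symm
    · exact h01 (by simpa [hφs, hφr] using (congrArg φ h).symm)
    · exact hs_add c _ _ ((add_comm _ _).trans h.symm)
    · exact h20 (by simpa only [map_add, hφs, hφr] using congrArg φ h)
    · exact h21 (by simpa only [map_add, hφs, hφr] using (congrArg φ h).symm)
  choose M hsub hmax using fun c => (hfree c).exists_isMaximalSumFree
  have hinj : Function.Injective fun c => (⟨M c, hmax c⟩ : {A : Set G // IsMaximalSumFree A}) := by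
    intro c c' h
    have hM : M c = M c' := congrArg Subtype.val h
    funext q
    by_contra hne
    have hsM : s ∈ M c := hsub c (Set.mem_insert _ _)
    have h1 : r c q ∈ M c := hsub c (Set.mem_insert_of_mem _ ⟨q, rfl⟩)
    have h2 : r c' q ∈ M c := hM ▸ hsub c' (Set.mem_insert_of_mem _ ⟨q, rfl⟩)
    rcases hK ((c q : G) - c' q) (K.sub_mem (c q).2 (c' q).2)
      (fun h0 => hne (Subtype.ext (sub_eq_zero.mp h0))) with hd | hd
    · refine (hmax c).1 s hsM _ h2 ?_
      convert h1 using 1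
      simp only [r, ← hd]
      abel
    · refine (hmax c).1 s hsM _ h1 ?_
      convert h2 using 1
      simp only [r, ← hd]
      abel
  calc 3 ^ m = Nat.card (Q → K) := by rw [Nat.card_fun, hKcard, hQ]
    _ ≤ _ := Nat.card_le_card_of_injective _ hinj

lemma mod_three_ne_two_of_forall_prime (n : ℕ)
    (hn : ∀ p : ℕ, p.Prime → p % 3 = 2 → ¬ p ∣ n) : n % 3 ≠ 2 := by
  induction n using Nat.recOnMul with
  | zero => simp
  | one => simp
  | prime p hp => exact fun h => hn p hp h dvd_rfl
  | mul a b ha hb =>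
    have ha' := ha fun p hp h hd => hn p hp h (hd.mul_right b)
    have hb' := hb fun p hp h hd => hn p hp h (hd.mul_left a)
    rw [Nat.mul_mod]
    have h1 := Nat.mod_lt a (show 0 < 3 by norm_num)
    have h2 := Nat.mod_lt b (show 0 < 3 by norm_num)
    interval_cases a % 3 <;> interval_cases b % 3 <;> simp_all

open scoped Pointwise in
/-- Among the sets `X` with `X + A ≠ G`, the quantity `|X + A| - |X|` is minimised by a
subgroup. -/
lemma exists_addSubgroup_card_add_le {G : Type*} [AddCommGroup G] [Fintype G] [DecidableEq G]
    {A : Finset G} (hA : ∃ X : Finset G, X.Nonempty ∧ X + A ≠ Finset.univ) :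
    ∃ (H : AddSubgroup G) (F : Finset G), (∀ x, x ∈ F ↔ x ∈ H) ∧ F + A ≠ Finset.univ ∧
      ∀ X : Finset G, X.Nonempty → X + A ≠ Finset.univ →
        (F + A).card + X.card ≤ (X + A).card + F.card := by
  let S : Finset (Finset G) := {X | X.Nonempty ∧ X + A ≠ Finset.univ}
  have hmemS : ∀ X, X ∈ S ↔ X.Nonempty ∧ X + A ≠ Finset.univ := fun X => by simp [S]
  let δ (X : Finset G) : ℤ := (X + A).card - X.card
  obtain ⟨X₀, hX₀, hmin₀⟩ := S.exists_min_image δ (hA.imp fun X hX => (hmemS X).mpr hX)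
  obtain ⟨X, hX, hmin⟩ := (S.filter fun X => δ X = δ X₀).exists_min_image Finset.card
    ⟨X₀, by simp [hX₀]⟩
  rw [Finset.mem_filter] at hX
  obtain ⟨hXS, hXδ⟩ := hX
  have hδ : ∀ Y ∈ S, δ X ≤ δ Y := fun Y hY => hXδ ▸ hmin₀ Y hY
  have hcard : ∀ Y ∈ S, δ Y ≤ δ X → X.card ≤ Y.card := fun Y hY h =>
    hmin Y (Finset.mem_filter.mpr ⟨hY, (h.antisymm (hδ Y hY)).trans hXδ⟩)
  obtain ⟨hXne, hXA⟩ := (hmemS X).mp hXS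
  have hvadd : ∀ (g : G) (Y : Finset G), (g +ᵥ Y) + A = g +ᵥ (Y + A) := fun g Y =>
    vadd_add_assoc g Y A
  have hδvadd : ∀ (g : G) (Y : Finset G), δ (g +ᵥ Y) = δ Y := fun g Y => by
    simp [δ, hvadd]
  have hSvadd : ∀ (g : G) (Y : Finset G), Y ∈ S → g +ᵥ Y ∈ S := by
    intro g Y hY
    rw [hmemS] at hY ⊢
    refine ⟨hY.1.vadd_finset, fun h => hY.2 ?_⟩
    rw [← Finset.card_eq_iff_eq_univ] at h ⊢
    rwa [hvadd, Finset.card_vadd_finset] at h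
  have hdual : X.card + (X + A).card ≤ Fintype.card G := by
    have hsub : -(X + A)ᶜ + A ⊆ (-X)ᶜ := by
      intro z hz
      obtain ⟨y, hy, a, ha, rfl⟩ := Finset.mem_add.mp hz
      rw [Finset.mem_neg'] at hy
      rw [Finset.mem_compl] at hy ⊢
      refine fun h => hy ?_
      rw [Finset.mem_neg'] at h
      exact Finset.mem_add.mpr ⟨_, h, a, ha, by abel⟩
    have hsub' := Finset.card_le_card hsub
    have hc1 := Finset.card_compl_add_card (-X)
    have hc2 := Finset.card_compl_add_card (X + A)
    have hX1 : 0 < X.card := hXne.card_pos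
    have hDS : -(X + A)ᶜ ∈ S := by
      rw [hmemS]
      constructor
      · rw [Finset.neg_nonempty_iff, Finset.nonempty_iff_ne_empty, Ne, Finset.compl_eq_empty_iff]
        exact hXA
      · intro h
        rw [h, Finset.card_univ] at hsub'
        rw [Finset.card_neg] at hc1
        omega
    have := hcard _ hDS (by
      simp only [δ, Finset.card_neg] at *
      omega)
    rw [Finset.card_neg] at this
    omega
  have htrans : ∀ g : G, (X ∩ (g +ᵥ X)).Nonempty → g +ᵥ X = X := by
    intro g hne
    by_contra hneq
    set Y := g +ᵥ X with hY
    have hYS : Y ∈ S := hSvadd g X hXS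
    have hYcard : Y.card = X.card := Finset.card_vadd_finset g X
    have hYA : (Y + A).card = (X + A).card := by rw [hY, hvadd, Finset.card_vadd_finset]
    have hlt : (X ∩ Y).card < X.card := by
      refine lt_of_le_of_ne (Finset.card_le_card Finset.inter_subset_left) fun h => hneq ?_
      have h1 : X ∩ Y = X := Finset.eq_of_subset_of_card_le Finset.inter_subset_left h.ge
      exact (Finset.eq_of_subset_of_card_le (Finset.inter_eq_left.mp h1) hYcard.le).symm
    have hIsub : X ∩ Y + A ⊆ (X + A) ∩ (Y + A) :=
      Finset.subset_inter (Finset.add_subset_add_right Finset.inter_subset_left)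
        (Finset.add_subset_add_right Finset.inter_subset_right)
    have hIS : X ∩ Y ∈ S := by
      rw [hmemS]
      refine ⟨hne, fun h => hXA ?_⟩
      rw [h] at hIsub
      exact Finset.univ_subset_iff.mp (hIsub.trans Finset.inter_subset_left)
    have hIδ : δ X < δ (X ∩ Y) := by
      by_contra! h
      exact absurd (hcard _ hIS h) (not_le.mpr hlt)
    have hIcard := Finset.card_le_card hIsub
    have hc1 := Finset.card_union_add_card_inter X Y
    have hc2 := Finset.card_union_add_card_inter (X + A) (Y + A)
    rw [← Finset.union_add] at hc2
    have hUS : X ∪ Y ∈ S := by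
      rw [hmemS]
      refine ⟨hXne.mono Finset.subset_union_left, fun h => ?_⟩
      have hI1 := hne.card_pos
      rw [h, Finset.card_univ] at hc2
      simp only [δ] at hIδ
      omega
    have := hδ _ hUS
    simp only [δ] at this hIδ
    omega
  obtain ⟨x₀, hx₀⟩ := hXne
  let F := -x₀ +ᵥ X
  have hF0 : (0 : G) ∈ F := Finset.mem_vadd_finset.mpr ⟨x₀, hx₀, by simp⟩
  have hFtrans : ∀ g ∈ F, -g +ᵥ F = F := by
    intro g hg
    have hgX : x₀ + g ∈ X := by
      obtain ⟨x, hx, rfl⟩ := Finset.mem_vadd_finset.mp hg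
      simpa using hx
    have h := htrans (-g) ⟨x₀, Finset.mem_inter.mpr
      ⟨hx₀, Finset.mem_vadd_finset.mpr ⟨x₀ + g, hgX, by simp⟩⟩⟩
    simp only [F]
    rw [vadd_comm, h]
  have hFneg : ∀ g ∈ F, -g ∈ F := fun g hg => by
    have := Finset.vadd_mem_vadd_finset (a := -g) hF0
    rwa [hFtrans g hg, vadd_eq_add, add_zero] at this
  let H : AddSubgroup G :=
    { carrier := F
      zero_mem' := hF0
      add_mem' := fun {a b} ha hb => by
        have := Finset.vadd_mem_vadd_finset (a := - -a) hb
        rwa [hFtrans _ (hFneg a ha), vadd_eq_add, neg_neg] at this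
      neg_mem' := fun {a} ha => hFneg a ha }
  refine ⟨H, F, fun x => Iff.rfl, ((hmemS F).mp (hSvadd _ _ hXS)).2, fun Y hY hYA => ?_⟩
  have h1 := hδ Y ((hmemS Y).mpr ⟨hY, hYA⟩)
  rw [← hδvadd (-x₀) X] at h1
  change δ F ≤ δ Y at h1
  simp only [δ] at h1
  omega

open scoped Pointwise in
/-- If no prime `p ≡ 2 (mod 3)` divides the order of `G`, then a sum-free subset of `G` contains
at most a third of its elements. -/
lemma IsSumFree.three_mul_card_le {G : Type*} [AddCommGroup G] [Finite G]
    (hG : ∀ p : ℕ, p.Prime → p % 3 = 2 → ¬ p ∣ Nat.card G) {A : Finset G}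
    (hA : IsSumFree (A : Set G)) : 3 * A.card ≤ Nat.card G := by
  induction hn : Nat.card G using Nat.strong_induction_on generalizing G with
  | _ n ih =>
  classical
  have := Fintype.ofFinite G
  by_contra! hlt
  have hmod := mod_three_ne_two_of_forall_prime _ hG
  rw [hn] at hmod
  have hcard : Fintype.card G = n := by rw [← Nat.card_eq_fintype_card, hn]
  have hAne : A.Nonempty := Finset.card_pos.mp (by omega)
  have hdisj : Disjoint (A + A) A := by
    rw [Finset.disjoint_left]
    intro z hz
    obtain ⟨x, hx, y, hy, rfl⟩ := Finset.mem_add.mp hz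
    exact hA x hx y hy
  have hAA : (A + A).card + A.card ≤ n := by
    rw [← Finset.card_union_of_disjoint hdisj, ← hcard]
    exact Finset.card_le_univ _
  have hAAne : A + A ≠ Finset.univ := fun h => by
    have := hAne.card_pos
    rw [h, Finset.card_univ, hcard] at hAA
    omega
  obtain ⟨H, F, hF, hFA, hmin⟩ := exists_addSubgroup_card_add_le ⟨A, hAne, hAAne⟩
  have hholes : (F + A).card + 2 ≤ A.card + F.card := by
    have := hmin A hAne hAAne
    omega
  have hF0 : (0 : G) ∈ F := (hF 0).mpr H.zero_mem
  have hAF : A ⊆ F + A := fun a ha => Finset.mem_add.mpr ⟨0, hF0, a, ha, zero_add a⟩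
  have hHcard : Nat.card H = F.card := by
    rw [← Nat.card_eq_finsetCard]
    exact Nat.card_congr (Equiv.subtypeEquivRight fun x => (hF x).symm)
  have hcoset : ∀ a x : G, x ∈ a +ᵥ F ↔ x - a ∈ H := by
    intro a x
    rw [← Finset.neg_vadd_mem_iff, hF, vadd_eq_add, neg_add_eq_sub]
  have hcosetA : ∀ a ∈ A, a +ᵥ F ⊆ F + A := fun a ha x hx => by
    rw [hcoset, ← hF] at hx
    exact Finset.mem_add.mpr ⟨_, hx, a, ha, by abel⟩
  -- `A` fills more than half of the union of any two distinct cosets of `H` that it meets.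
  have hfill : ∀ a ∈ A, ∀ b ∈ A, a - b ∉ H →
      F.card < (A ∩ (a +ᵥ F)).card + (A ∩ (b +ᵥ F)).card := by
    intro a ha b hb hab
    have hd : Disjoint (a +ᵥ F) (b +ᵥ F) := by
      rw [Finset.disjoint_left]
      intro x hxa hxb
      rw [hcoset] at hxa hxb
      exact hab (by simpa using H.sub_mem hxb hxa)
    have hsub := Finset.card_le_card (Finset.sdiff_subset_sdiff hAF
      (Finset.Subset.refl ((a +ᵥ F) ∪ (b +ᵥ F))))
    rw [Finset.card_sdiff_of_subset (Finset.union_subset (hcosetA a ha) (hcosetA b hb)),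
      Finset.card_union_of_disjoint hd, Finset.card_vadd_finset, Finset.card_vadd_finset] at hsub
    have h1 := Finset.card_inter_add_card_sdiff A ((a +ᵥ F) ∪ (b +ᵥ F))
    rw [Finset.inter_union_distrib_left] at h1
    have h2 := Finset.card_union_le (A ∩ (a +ᵥ F)) (A ∩ (b +ᵥ F))
    have h3 := Finset.card_le_card (Finset.union_subset (hcosetA a ha) (hcosetA b hb))
    rw [Finset.card_union_of_disjoint hd, Finset.card_vadd_finset, Finset.card_vadd_finset] at h3
    omega
  have hsum : ∀ a ∈ A, ∀ b ∈ A, a - b ∉ H → ∀ g, g - (a + b) ∈ H → g ∉ A := by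
    intro a ha b hb hab g hg hgA
    have hV : (A ∩ (b +ᵥ F)).image (fun x => g - x) ⊆ a +ᵥ F := by
      intro y hy
      obtain ⟨x, hx, rfl⟩ := Finset.mem_image.mp hy
      have hx' := (hcoset _ _).mp (Finset.mem_inter.mp hx).2
      rw [hcoset]
      convert H.sub_mem hg hx' using 1
      abel
    obtain ⟨z, hz⟩ := Finset.inter_nonempty_of_card_lt_card_add_card
      (Finset.inter_subset_right (s₁ := A)) hV (by
        rw [Finset.card_vadd_finset, Finset.card_image_of_injective _ sub_right_injective]
        exact hfill a ha b hb hab)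
    obtain ⟨hz1, hz2⟩ := Finset.mem_inter.mp hz
    obtain ⟨x, hx, rfl⟩ := Finset.mem_image.mp hz2
    exact hA _ (Finset.mem_inter.mp hz1).1 x (Finset.mem_inter.mp hx).1 (by simpa using hgA)
  have hdiff : ∀ a ∈ A, ∀ b ∈ A, a - b ∉ H → ∀ g, g - (a - b) ∈ H → g ∉ A := by
    intro a ha b hb hab g hg hgA
    have hV : (A ∩ (b +ᵥ F)).image (fun x => g + x) ⊆ a +ᵥ F := by
      intro y hy
      obtain ⟨x, hx, rfl⟩ := Finset.mem_image.mp hy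
      have hx' := (hcoset _ _).mp (Finset.mem_inter.mp hx).2
      rw [hcoset]
      convert H.add_mem hg hx' using 1
      abel
    obtain ⟨z, hz⟩ := Finset.inter_nonempty_of_card_lt_card_add_card
      (Finset.inter_subset_right (s₁ := A)) hV (by
        rw [Finset.card_vadd_finset, Finset.card_image_of_injective _ (add_right_injective g)]
        exact hfill a ha b hb hab)
    obtain ⟨hz1, hz2⟩ := Finset.mem_inter.mp hz
    obtain ⟨x, hx, rfl⟩ := Finset.mem_image.mp hz2
    exact hA g hgA x (Finset.mem_inter.mp hx).1 (Finset.mem_inter.mp hz1).1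
  have hindex := H.card_mul_index
  rw [hHcard, hn] at hindex
  have hH_ne_top : H ≠ ⊤ := by
    rintro rfl
    obtain ⟨a, ha⟩ := hAne
    refine hFA (Finset.eq_univ_of_forall fun x => Finset.mem_add.mpr ⟨x - a, ?_, a, ha, by simp⟩)
    exact (hF _).mpr trivial
  have hAH : ¬ ∀ a ∈ A, a ∈ H := by
    intro h
    have h1 : A.card ≤ F.card := Finset.card_le_card fun a ha => (hF a).mpr (h a ha)
    have h2 : H.index ≠ 1 := fun h => hH_ne_top (AddSubgroup.index_eq_one.mp h)
    have h3 : H.index ≠ 2 := fun h =>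
      hG 2 Nat.prime_two rfl (hn ▸ hindex ▸ h ▸ dvd_mul_left _ _)
    have h0 : H.index ≠ 0 := AddSubgroup.index_ne_zero_of_finite
    have : F.card * 3 ≤ n := hindex ▸ Nat.mul_le_mul_left _ (by omega)
    omega
  have hfree : IsSumFree ((A.image (QuotientAddGroup.mk' H) : Finset (G ⧸ H)) : Set (G ⧸ H)) := by
    intro u hu v hv hw
    simp only [Finset.coe_image, Set.mem_image, Finset.mem_coe] at hu hv hw
    obtain ⟨x, hx, rfl⟩ := hu
    obtain ⟨y, hy, rfl⟩ := hv
    obtain ⟨z, hz, hzxy⟩ := hw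
    have hzxy : z - (x + y) ∈ H := by
      rw [← QuotientAddGroup.eq_zero_iff, QuotientAddGroup.mk_sub, sub_eq_zero]
      exact hzxy
    by_cases hxy : x - y ∈ H
    · by_cases hzx : z - x ∈ H
      · have hxH : x ∈ H := by
          convert H.add_mem (H.sub_mem hzx hzxy) hxy using 1
          abel
        push Not at hAH
        obtain ⟨f, hf, hfH⟩ := hAH
        refine hsum x hx f hf (fun h => hfH ?_) f ?_ hf
        · simpa using H.sub_mem hxH h
        · simpa using hxH
      · refine hdiff z hz x hx hzx x ?_ hx
        convert H.sub_mem hxy hzxy using 1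
        abel
    · exact hsum x hx y hy hxy z hzxy hz
  have hF2 : 2 ≤ F.card := by
    have := Finset.card_le_card hAF
    omega
  have hQ : F.card * Nat.card (G ⧸ H) = n := hindex
  have hQpos : 0 < Nat.card (G ⧸ H) := Nat.card_pos
  have hQlt : Nat.card (G ⧸ H) < n := by nlinarith
  have hrec := ih _ hQlt (fun p hp h2 hd => hG p hp h2
    (hn ▸ hQ ▸ hd.mul_left _)) hfree rfl
  have hle := Finset.card_le_mul_card_image (f := QuotientAddGroup.mk' H) A F.card (by
    intro b hb
    obtain ⟨a, -, rfl⟩ := Finset.mem_image.mp hb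
    rw [← Finset.card_vadd_finset a F]
    refine Finset.card_le_card fun x hx => ?_
    rw [hcoset, ← QuotientAddGroup.eq_zero_iff, QuotientAddGroup.mk_sub, sub_eq_zero]
    exact (Finset.mem_filter.mp hx).2)
  nlinarith

/-- If `3` divides the order of `G` and no prime `p ≡ 2 (mod 3)` does, then `μ(G) = |G| / 3`. -/
lemma three_mul_sumFreeMu {G : Type*} [AddCommGroup G] [Fintype G] (h3 : 3 ∣ Nat.card G)
    (hG : ∀ p : ℕ, p.Prime → p % 3 = 2 → ¬ p ∣ Nat.card G) :
    3 * sumFreeMu G = Nat.card G := by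
  classical
  have hbound : ∀ k ∈ {k : ℕ | ∃ A : Set G, IsSumFree A ∧ A.ncard = k}, k ≤ Nat.card G / 3 := by
    rintro k ⟨A, hA, rfl⟩
    rw [Set.ncard_eq_toFinset_card']
    have := IsSumFree.three_mul_card_le hG (A := A.toFinset) (by simpa using hA)
    omega
  obtain ⟨φ, hφ⟩ := exists_surjective_zmod (G := G) 3 h3
  have hfib := mul_card_fiber_eq_card hφ 1
  have hmem : Nat.card {x // φ x = 1} ∈ {k : ℕ | ∃ A : Set G, IsSumFree A ∧ A.ncard = k} := by
    refine ⟨{x | φ x = 1}, fun x hx y hy hxy => ?_, rfl⟩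
    simp only [Set.mem_ofPred_eq, map_add] at hx hy hxy
    rw [hx, hy] at hxy
    exact absurd hxy (by decide)
  have h1 : sumFreeMu G ≤ Nat.card G / 3 := csSup_le ⟨_, hmem⟩ hbound
  have h2 : Nat.card {x // φ x = 1} ≤ sumFreeMu G := le_csSup ⟨_, hbound⟩ hmem
  omega

theorem many_maximal_sumfree_sets_of_order_divisible_by_nine
    (G : Type) [AddCommGroup G] [Fintype G] (h9 : 9 ∣ Fintype.card G) :
    (fMaxSF G : ℝ) ≥ 3 ^ ((Fintype.card G : ℝ) / 9) ∧
      ((∀ p : ℕ, p.Prime → p % 3 = 2 → ¬ p ∣ Fintype.card G) →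
        (sumFreeMu G : ℝ) = (Fintype.card G : ℝ) / 3 ∧
          (fMaxSF G : ℝ) ≥ 3 ^ ((sumFreeMu G : ℝ) / 3)) := by
  rw [← Nat.card_eq_fintype_card] at h9 ⊢
  obtain ⟨m, hm⟩ := h9
  have h3 : 3 ∣ Nat.card G := by omega
  obtain ⟨φ, hφ⟩ := exists_surjective_zmod 3 h3
  have hker : 3 * Nat.card φ.ker = Nat.card G := mul_card_fiber_eq_card hφ 0
  obtain ⟨s, hs⟩ := exists_prime_addOrderOf_dvd_card' (G := φ.ker) 3 (by omega)
  have hcount : 3 ^ m ≤ fMaxSF G :=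
    three_pow_le_card_isMaximalSumFree hφ (by rwa [AddSubgroup.addOrderOf_coe]) s.2 hm
  have hfmax : (fMaxSF G : ℝ) ≥ 3 ^ ((Nat.card G : ℝ) / 9) := by
    have : (Nat.card G : ℝ) / 9 = (m : ℕ) := by
      rw [hm]
      push_cast
      ring
    rw [this, Real.rpow_natCast]
    exact_mod_cast hcount
  refine ⟨hfmax, fun hG => ?_⟩
  have hμ : (sumFreeMu G : ℝ) = (Nat.card G : ℝ) / 3 := by
    rw [← three_mul_sumFreeMu h3 hG]
    push_cast
    ring
  refine ⟨hμ, ?_⟩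
  rw [hμ, div_div]
  norm_num at hfmax ⊢
  exact hfmax
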